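/- Let a, b, c be natural numbers and let ∂₁ : ℤ^a → ℤ^b and ∂₀ : ℤ^b → ℤ^c be ℤ-linear maps with ∂₀ ∘ ∂₁ = 0. Let β ≥ 1 be a real number such that ‖∂₁(e_i)‖² ≤ β for every standard basis vector e_i of ℤ^a, where ‖·‖ is the Euclidean norm on ℤ^b ⊆ ℝ^b. Then the torsion subgroup of the homology group H = ker(∂₀) / im(∂₁) is finite of cardinality at most β^{(1/2)·min(a,b)}. -/

import Mathlib

/-- Hadamard's inequality for the rows of an integer matrix. -/
theorem Matrix.abs_det_intCast_le_prod_sqrt {n : ℕ} (M : Matrix (Fin n) (Fin n) ℤ) :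
    |(M.det : ℝ)| ≤ ∏ i, √(∑ j, (M i j : ℝ) ^ 2) := by
  let B := EuclideanSpace.basisFun (Fin n) ℝ
  have : Fact (Module.finrank ℝ (EuclideanSpace ℝ (Fin n)) = n) := ⟨by simp⟩
  let w : Fin n → EuclideanSpace ℝ (Fin n) := fun i => WithLp.toLp 2 fun j => (M i j : ℝ)
  have hdet : B.toBasis.det w = (M.det : ℝ) := by
    have hmat : B.toBasis.toMatrix w = (M.map (Int.cast : ℤ → ℝ)).transpose := by
      ext i j
      simp [B, w, Module.Basis.toMatrix_apply]
    rw [Module.Basis.det_apply, hmat, Matrix.det_transpose, Int.cast_det]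
  have h := B.toBasis.orientation.abs_volumeForm_apply_le w
  rw [Orientation.volumeForm_robust' _ B, hdet] at h
  simpa [w, EuclideanSpace.norm_eq] using h

/-- Coordinatewise inclusion of integer vectors into real vectors. -/
def intVecToReal (b : ℕ) : (Fin b → ℤ) →ₗ[ℤ] (Fin b → ℝ) :=
  (Algebra.linearMap ℤ ℝ).compLeft (Fin b)

@[simp]
theorem intVecToReal_apply {b : ℕ} (x : Fin b → ℤ) (j : Fin b) :
    intVecToReal b x j = (x j : ℝ) := rfl

theorem intVecToReal_injective (b : ℕ) : Function.Injective (intVecToReal b) := by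
  intro x y h
  ext j
  simpa using congrFun h j

theorem intVecToReal_single {b : ℕ} (j : Fin b) :
    intVecToReal b (Pi.single j 1) = Pi.single j 1 := by
  ext k
  by_cases h : k = j
  · subst h; simp
  · simp [h]

/-- Integer vectors that are independent over the reals are independent over the integers. -/
theorem LinearIndependent.of_intVecToReal {ι : Type*} {b : ℕ} {v : ι → Fin b → ℤ}
    (hv : LinearIndependent ℝ fun k => intVecToReal b (v k)) : LinearIndependent ℤ v := by
  have h : LinearIndependent ℤ fun k => intVecToReal b (v k) :=
    hv.restrict_scalars (by
      intro m n hmn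
      simpa using hmn)
  exact LinearIndependent.of_comp (intVecToReal b) h

/-- The lattice spanned by `b` independent vectors of `ℤ^b` has finite index, at most the product
of the Euclidean norms of the vectors. -/
theorem finite_quotient_span_and_card_le {b : ℕ} (v : Fin b → Fin b → ℤ)
    (hv : LinearIndependent ℝ fun k => intVecToReal b (v k)) :
    Finite ((Fin b → ℤ) ⧸ Submodule.span ℤ (Set.range v)) ∧
      (Nat.card ((Fin b → ℤ) ⧸ Submodule.span ℤ (Set.range v)) : ℝ) ≤
        ∏ k, √(∑ j, (v k j : ℝ) ^ 2) := by
  have hcard : (Matrix.of v).det.natAbs =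
      Nat.card ((Fin b → ℤ) ⧸ Submodule.span ℤ (Set.range v)) := by
    rw [← Submodule.natAbs_det_basis_change (Pi.basisFun ℤ (Fin b)) _
      (Module.Basis.span hv.of_intVecToReal), Pi.basisFun_det_apply]
    congr 3
    ext k j
    simp [Module.Basis.span_apply]
  have hdet : (Matrix.of v).det ≠ 0 := by
    have hu : IsUnit ((Matrix.of v).map (Int.cast : ℤ → ℝ)) :=
      Matrix.linearIndependent_rows_iff_isUnit.mp hv
    rw [Matrix.isUnit_iff_isUnit_det, ← Int.cast_det] at hu
    exact_mod_cast hu.ne_zero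
  constructor
  · refine Nat.finite_of_card_ne_zero ?_
    rw [← hcard]
    exact Int.natAbs_ne_zero.mpr hdet
  · rw [← hcard, Nat.cast_natAbs, Int.cast_abs]
    exact Matrix.abs_det_intCast_le_prod_sqrt (Matrix.of v)

/-- A maximal independent subfamily of `f`, completed by standard basis vectors to a basis. -/
theorem exists_basis_selection {a b : ℕ} (f : Fin a → Fin b → ℤ) :
    ∃ s : Fin b → Fin a ⊕ Fin b, Function.Injective s ∧
      LinearIndependent ℝ (fun k =>
        intVecToReal b (Sum.elim f (fun j => Pi.single j 1) (s k))) ∧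
      ∀ i, intVecToReal b (f i) ∈ Submodule.span ℝ
        ((fun k => intVecToReal b (Sum.elim f (fun j => Pi.single j 1) (s k))) ''
          {k | (s k).isLeft}) := by
  set w : Fin a ⊕ Fin b → Fin b → ℝ :=
    fun x => intVecToReal b (Sum.elim f (fun j => Pi.single j 1) x) with hw
  obtain ⟨S, hSl, -, hSspan, hSind⟩ := exists_linearIndepOn_extension
    (linearIndepOn_empty ℝ w) (Set.empty_subset (Set.range Sum.inl))
  obtain ⟨T, -, hST, hTspan, hTind⟩ := exists_linearIndepOn_extension hSind (Set.subset_univ S)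
  have htop : ⊤ ≤ Submodule.span ℝ (Set.range fun x : T => w x) := by
    rw [← (Pi.basisFun ℝ (Fin b)).span_eq, Submodule.span_le]
    rintro _ ⟨j, rfl⟩
    have := hTspan ⟨Sum.inr j, trivial, rfl⟩
    rw [Set.image_eq_range] at this
    simpa [hw, intVecToReal_single] using this
  have := Fintype.ofFinite T
  have hcard : Fintype.card T = b := by
    simpa using (Module.finrank_eq_card_basis (Module.Basis.mk hTind htop)).symm
  let e : Fin b ≃ T := (Fintype.equivFinOfCardEq hcard).symm
  refine ⟨fun k => e k, Subtype.val_injective.comp e.injective, hTind.comp e e.injective, ?_⟩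
  intro i
  refine Submodule.span_mono ?_ (hSspan ⟨Sum.inl i, ⟨i, rfl⟩, rfl⟩)
  rintro _ ⟨x, hx, rfl⟩
  refine ⟨e.symm ⟨x, hST hx⟩, ?_, by simp [hw]⟩
  obtain ⟨i', rfl⟩ := hSl hx
  simp

/-- If `v` is independent over the reals, an integer combination of `v` lying in the real span of
a subfamily is an integer combination of that subfamily. -/
theorem mem_span_image_of_intVecToReal_mem {ι : Type*} {b : ℕ} {v : ι → Fin b → ℤ}
    (hv : LinearIndependent ℝ fun k => intVecToReal b (v k)) (A : Set ι) {x : Fin b → ℤ}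
    (hx : x ∈ Submodule.span ℤ (Set.range v))
    (hxA : intVecToReal b x ∈ Submodule.span ℝ ((fun k => intVecToReal b (v k)) '' A)) :
    x ∈ Submodule.span ℤ (v '' A) := by
  obtain ⟨c, rfl⟩ := Finsupp.mem_span_range_iff_exists_finsupp.mp hx
  obtain ⟨l, hl, hlx⟩ := (Finsupp.mem_span_image_iff_linearCombination ℝ).mp hxA
  have hc : Finsupp.linearCombination ℝ (fun k => intVecToReal b (v k))
      (c.mapRange (Int.cast : ℤ → ℝ) Int.cast_zero) = intVecToReal b (c.sum fun i m => m • v i) := by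
    rw [Finsupp.linearCombination_apply, Finsupp.sum_mapRange_index (by simp), Finsupp.sum,
      Finsupp.sum, map_sum]
    refine Finset.sum_congr rfl fun k _ => ?_
    rw [map_smul, Int.cast_smul_eq_zsmul]
  have hlc : l = c.mapRange (Int.cast : ℤ → ℝ) Int.cast_zero := hv (hlx.trans hc.symm)
  refine Submodule.sum_mem _ fun k hk => Submodule.smul_mem _ _ (Submodule.subset_span ⟨k, ?_, rfl⟩)
  refine (Finsupp.mem_supported ℝ l).mp hl ?_
  simpa [hlc] using hk


/-- If `∂₁ : ℤ^a → ℤ^b` and `∂₀ : ℤ^b → ℤ^c` are `ℤ`-linear maps with `∂₀ ∘ ∂₁ = 0`,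
and every image `∂₁(e_i)` of a standard basis vector has squared Euclidean norm at
most `β` (with `β ≥ 1`), then the torsion subgroup of the homology group
`ker ∂₀ / im ∂₁` is finite of cardinality at most `β ^ ((min a b) / 2)`. -/
theorem torsion_homology_bound (a b c : ℕ)
    (d1 : (Fin a → ℤ) →ₗ[ℤ] (Fin b → ℤ)) (d0 : (Fin b → ℤ) →ₗ[ℤ] (Fin c → ℤ))
    (hcomp : d0.comp d1 = 0)
    (hrange : ∀ x, d1 x ∈ LinearMap.ker d0)
    (β : ℝ) (hβ : 1 ≤ β)
    (hd1 : ∀ i : Fin a, ∑ j : Fin b, ((d1 (Pi.single i 1)) j : ℝ) ^ 2 ≤ β) :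
    Finite (Submodule.torsion ℤ
        ((LinearMap.ker d0) ⧸ LinearMap.range (d1.codRestrict (LinearMap.ker d0) hrange))) ∧
      (Nat.card (Submodule.torsion ℤ
        ((LinearMap.ker d0) ⧸ LinearMap.range (d1.codRestrict (LinearMap.ker d0) hrange))) : ℝ)
        ≤ β ^ ((min a b : ℝ) / 2) := by
  obtain ⟨s, hs, hind, hspan⟩ := exists_basis_selection fun i => d1 (Pi.single i 1)
  set v : Fin b → Fin b → ℤ :=
    fun k => Sum.elim (fun i => d1 (Pi.single i 1)) (fun j => Pi.single j 1) (s k) with hv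
  set A : Set (Fin b) := {k | (s k).isLeft}
  obtain ⟨hfin, hle⟩ := finite_quotient_span_and_card_le v hind
  have hd1span : ∀ y, intVecToReal b (d1 y) ∈
      Submodule.span ℝ ((fun k => intVecToReal b (v k)) '' A) := by
    intro y
    rw [pi_eq_sum_univ' y, map_sum, map_sum]
    refine Submodule.sum_mem _ fun i _ => ?_
    rw [map_smul, map_smul]
    exact Submodule.smul_of_tower_mem _ _ (hspan i)
  have hAle : Submodule.span ℤ (v '' A) ≤ LinearMap.range d1 := by
    rw [Submodule.span_le]
    rintro _ ⟨k, hk, rfl⟩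
    obtain ⟨i, hi⟩ := Sum.isLeft_iff.mp hk
    exact ⟨Pi.single i 1, by simp [hv, hi]⟩
  set L := LinearMap.range (d1.codRestrict (LinearMap.ker d0) hrange)
  have hsat : ∀ t : Submodule.torsion ℤ (LinearMap.ker d0 ⧸ L),
      intVecToReal b (Quotient.out t.1 : LinearMap.ker d0) ∈
        Submodule.span ℝ ((fun k => intVecToReal b (v k)) '' A) := by
    rintro ⟨t, ht⟩
    obtain ⟨⟨m, hm⟩, hmt⟩ := (Submodule.mem_torsion_iff t).mp ht
    have hout : L.mkQ (Quotient.out t) = t := Quotient.out_eq t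
    have hmem : m • (Quotient.out t : LinearMap.ker d0) ∈ L := by
      rw [← Submodule.Quotient.mk_eq_zero, ← Submodule.mkQ_apply, map_smul, hout]
      exact hmt
    obtain ⟨y, hy⟩ := hmem
    have hy' : d1 y = m • ((Quotient.out t : LinearMap.ker d0) : Fin b → ℤ) :=
      congrArg Subtype.val hy
    have hmem := hd1span y
    rw [hy', map_smul, ← Int.cast_smul_eq_zsmul ℝ] at hmem
    have hm0 : (m : ℝ) ≠ 0 := by exact_mod_cast nonZeroDivisors.ne_zero hm
    exact (Submodule.smul_mem_iff _ hm0).mp hmem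
  let g : Submodule.torsion ℤ (LinearMap.ker d0 ⧸ L) →
      (Fin b → ℤ) ⧸ Submodule.span ℤ (Set.range v) :=
    fun t => Submodule.Quotient.mk ((Quotient.out t.1 : LinearMap.ker d0) : Fin b → ℤ)
  have hg : Function.Injective g := by
    intro t t' h
    have hdiff := mem_span_image_of_intVecToReal_mem hind A ((Submodule.Quotient.eq _).mp h)
      (by rw [map_sub]; exact Submodule.sub_mem _ (hsat t) (hsat t'))
    obtain ⟨y, hy⟩ := hAle hdiff
    have hmem : (Quotient.out t.1 : LinearMap.ker d0) - Quotient.out t'.1 ∈ L :=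
      ⟨y, Subtype.ext hy⟩
    have heq := (Submodule.Quotient.eq L).mpr hmem
    have hout : ∀ u : LinearMap.ker d0 ⧸ L, Submodule.Quotient.mk (Quotient.out u) = u :=
      fun u => Quotient.out_eq u
    rw [hout, hout] at heq
    exact Subtype.ext heq
  refine ⟨Finite.of_injective g hg, ?_⟩
  set F : Finset (Fin b) := Finset.univ.filter fun k => (s k).isLeft
  have hFb : F.card ≤ b := (Finset.card_le_univ F).trans_eq (Fintype.card_fin b)
  have hFa : F.card ≤ a := by
    have hsub : F.map ⟨s, hs⟩ ⊆ Finset.univ.map Function.Embedding.inl := by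
      intro x hx
      obtain ⟨k, hk, rfl⟩ := Finset.mem_map.mp hx
      obtain ⟨i, hi⟩ := Sum.isLeft_iff.mp (Finset.mem_filter.mp hk).2
      simp [hi]
    simpa using Finset.card_le_card hsub
  have hnorm : ∀ k, √(∑ j, (v k j : ℝ) ^ 2) ≤ if (s k).isLeft then √β else 1 := by
    intro k
    rcases hk : s k with i | j
    · simpa [hv, hk] using Real.sqrt_le_sqrt (hd1 i)
    · simp [hv, hk, Pi.single_apply]
  calc (Nat.card (Submodule.torsion ℤ (LinearMap.ker d0 ⧸ L)) : ℝ)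
      ≤ Nat.card ((Fin b → ℤ) ⧸ Submodule.span ℤ (Set.range v)) := by
        exact_mod_cast Nat.card_le_card_of_injective g hg
    _ ≤ ∏ k, √(∑ j, (v k j : ℝ) ^ 2) := hle
    _ ≤ ∏ k, if (s k).isLeft then √β else 1 :=
        Finset.prod_le_prod (fun _ _ => Real.sqrt_nonneg _) fun k _ => hnorm k
    _ = √β ^ F.card := by
        rw [← Finset.prod_filter, Finset.prod_const]
    _ = β ^ ((F.card : ℝ) / 2) := by
        rw [Real.sqrt_eq_rpow, ← Real.rpow_mul_natCast (by linarith)]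
        ring_nf
    _ ≤ β ^ ((min a b : ℝ) / 2) := by
        refine Real.rpow_le_rpow_of_exponent_le hβ ?_
        have h : (F.card : ℝ) ≤ min (a : ℝ) b := le_min (mod_cast hFa) (mod_cast hFb)
        linarith
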